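/- arXiv:2001.06850 — 6 statements merged into one kernel-verified Lean document; each statement's English description precedes it below -/
import Mathlib

section
/- Let G1, G2, σ², p0 > 0 and let γ̄ satisfy 0 < γ̄ ≤ p0·G2/σ². Define p1* = p0 − γ̄·(p0·G2 + σ²)/(G2·(1 + γ̄)). Then: (i) 0 ≤ p1* < p0; (ii) for every pair (p1, p2) of nonnegative reals with p1 + p2 ≤ p0 and p2·G2/(p1·G2 + σ²) ≥ γ̄, one has p1 ≤ p1*; (iii) the pair (p1*, p0 − p1*) is itself feasible, with (p0 − p1*)·G2/(p1*·G2 + σ²) = γ̄ and p1* + (p0 − p1*) = p0. Consequently the maximum of log2(1 + p1·G1/σ²) over the feasible set is attained at p1 = p1*, where both constraints hold with equality. -/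
/-- Proposition 1 together with the explicit optimal power allocation (21):
under the NOMA scheme, the UAV throughput `log2(1 + p1·G1/σ²)` is maximized
over the feasible set at `p1* = p0 − γ̄·(p0·G2 + σ²)/(G2·(1 + γ̄))`, where both
the power constraint and the GU's SINR constraint hold with equality. -/
theorem noma_optimal_power_allocation
    (G1 G2 σ2 p0 γ : ℝ)
    (hG1 : 0 < G1) (hG2 : 0 < G2) (hσ2 : 0 < σ2) (hp0 : 0 < p0)
    (hγ : 0 < γ) (hγle : γ ≤ p0 * G2 / σ2) :
    let p1s : ℝ := p0 - γ * (p0 * G2 + σ2) / (G2 * (1 + γ))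
    -- (i) 0 ≤ p1* < p0
    (0 ≤ p1s ∧ p1s < p0) ∧
    -- (ii) every feasible p1 satisfies p1 ≤ p1*
    (∀ p1 p2 : ℝ, 0 ≤ p1 → 0 ≤ p2 → p1 + p2 ≤ p0 →
      p2 * G2 / (p1 * G2 + σ2) ≥ γ → p1 ≤ p1s) ∧
    -- (iii) (p1*, p0 − p1*) is feasible with both constraints active
    ((p0 - p1s) * G2 / (p1s * G2 + σ2) = γ ∧ p1s + (p0 - p1s) = p0) ∧
    -- consequence: the maximum of the UAV throughput is attained at p1*
    IsGreatest
      {x : ℝ | ∃ p1 p2 : ℝ, 0 ≤ p1 ∧ 0 ≤ p2 ∧ p1 + p2 ≤ p0 ∧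
        p2 * G2 / (p1 * G2 + σ2) ≥ γ ∧ x = Real.logb 2 (1 + p1 * G1 / σ2)}
      (Real.logb 2 (1 + p1s * G1 / σ2)) := by
  intro p1s
  have hD : 0 < G2 * (1 + γ) := by positivity
  have hkey : p1s * (G2 * (1 + γ)) = p0 * G2 - γ * σ2 := by
    simp only [p1s]
    field_simp
    ring
  have hσγ : γ * σ2 ≤ p0 * G2 := (le_div_iff₀ hσ2).mp hγle
  have hnonneg : 0 ≤ p1s := nonneg_of_mul_nonneg_left (by linarith) hD
  have hlt : p1s < p0 := sub_lt_self p0 (by positivity)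
  have hbound : ∀ p1 p2 : ℝ, 0 ≤ p1 → 0 ≤ p2 → p1 + p2 ≤ p0 →
      p2 * G2 / (p1 * G2 + σ2) ≥ γ → p1 ≤ p1s := by
    intro p1 p2 h1 _ hsum hq
    have hq' : γ * (p1 * G2 + σ2) ≤ p2 * G2 := (le_div_iff₀ (by positivity)).mp hq
    have hpow : (p1 + p2) * G2 ≤ p0 * G2 := mul_le_mul_of_nonneg_right hsum hG2.le
    exact le_of_mul_le_mul_right (by linarith) hD
  have hsinr : (p0 - p1s) * G2 / (p1s * G2 + σ2) = γ := by
    rw [div_eq_iff (by positivity)]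
    linarith
  refine ⟨⟨hnonneg, hlt⟩, hbound, ⟨hsinr, add_sub_cancel p1s p0⟩, ?_, ?_⟩
  · exact ⟨p1s, p0 - p1s, hnonneg, sub_nonneg.mpr hlt.le, (add_sub_cancel p1s p0).le,
      hsinr.ge, rfl⟩
  · rintro x ⟨p1, p2, h1, h2, hsum, hq, rfl⟩
    have hle := hbound p1 p2 h1 h2 hsum hq
    exact Real.logb_le_logb_of_le one_lt_two (by positivity) (by gcongr)
end

section
/- Let M, p0, β, μ0, σ², G1, G3 > 0. For m1 ∈ (0, M) define t(m1) = (M·p0 − (M − m1)·(2^{β·μ0/(M − m1)} − 1)·σ²/G3)·G1/σ² and μ(m1) = m1·log2(1 + t(m1)/m1) − β·μ0. Then the set S = {m1 ∈ (0, M) : t(m1) ≥ 0} is convex, and μ is concave on S. -/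
/-- The perspective `(x, y) ↦ x * g (y / x)` of a concave function satisfies the concavity
inequality on `x > 0`. -/
lemma ConcaveOn.perspective_le {s : Set ℝ} {g : ℝ → ℝ} (hg : ConcaveOn ℝ s g)
    {x₁ x₂ y₁ y₂ a b : ℝ} (hx₁ : 0 < x₁) (hx₂ : 0 < x₂) (h₁ : y₁ / x₁ ∈ s) (h₂ : y₂ / x₂ ∈ s)
    (ha : 0 ≤ a) (hb : 0 ≤ b) (hab : a + b = 1) :
    a * (x₁ * g (y₁ / x₁)) + b * (x₂ * g (y₂ / x₂)) ≤
      (a * x₁ + b * x₂) * g ((a * y₁ + b * y₂) / (a * x₁ + b * x₂)) := by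
  have hX : 0 < a * x₁ + b * x₂ := convex_Ioi (0 : ℝ) hx₁ hx₂ ha hb hab
  have hw₁ : 0 ≤ a * x₁ / (a * x₁ + b * x₂) := by positivity
  have hw₂ : 0 ≤ b * x₂ / (a * x₁ + b * x₂) := by positivity
  have key := hg.2 h₁ h₂ hw₁ hw₂ (by field_simp)
  have harg : a * x₁ / (a * x₁ + b * x₂) * (y₁ / x₁) + b * x₂ / (a * x₁ + b * x₂) * (y₂ / x₂) =
      (a * y₁ + b * y₂) / (a * x₁ + b * x₂) := by
    field_simp
  simp only [smul_eq_mul, harg] at key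
  refine le_of_eq_of_le ?_ (mul_le_mul_of_nonneg_left key hX.le)
  field_simp

lemma concaveOn_one_sub_two_rpow :
    ConcaveOn ℝ Set.univ (fun u : ℝ => 1 - (2 : ℝ) ^ u) :=
  (concaveOn_const 1 convex_univ).sub (convexOn_rpow_left two_pos)

lemma concaveOn_logb_two_one_add :
    ConcaveOn ℝ (Set.Ici 0) (fun u : ℝ => Real.logb 2 (1 + u)) := by
  have hlog : ConcaveOn ℝ (Set.Ici 0) (fun u : ℝ => Real.log (1 + u)) :=
    (strictConcaveOn_log_Ioi.concaveOn.translate_right 1).subset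
      (fun u (hu : 0 ≤ u) => by simp only [Set.mem_preimage, Set.mem_Ioi]; linarith)
      (convex_Ici 0)
  have h := hlog.smul (inv_nonneg.2 (Real.log_nonneg one_le_two))
  refine h.congr fun u _ => ?_
  simp only [smul_eq_mul, Real.logb, div_eq_inv_mul]

/-- The power left for the first hop, scaled by the channel gain, is concave in the blocklength. -/
lemma concaveOn_const_sub_mul_two_rpow (M P c k : ℝ) (hk : 0 ≤ k) :
    ConcaveOn ℝ (Set.Ioo 0 M)
      (fun m : ℝ => P - k * ((M - m) * ((2 : ℝ) ^ (c / (M - m)) - 1))) := by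
  refine ⟨convex_Ioo 0 M, fun x hx y hy a b ha hb hab => ?_⟩
  have h := concaveOn_one_sub_two_rpow.perspective_le (y₁ := c) (y₂ := c) (sub_pos.2 hx.2)
    (sub_pos.2 hy.2) (Set.mem_univ _) (Set.mem_univ _) ha hb hab
  have hc : a * c + b * c = c := by rw [← add_mul, hab, one_mul]
  have hX : a * (M - x) + b * (M - y) = M - (a * x + b * y) := by linear_combination M * hab
  rw [hc, hX] at h
  have hP : a * P + b * P = P := by rw [← add_mul, hab, one_mul]
  simp only [smul_eq_mul]
  linarith [mul_le_mul_of_nonneg_left h hk]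

/-- `m ↦ m * logb 2 (1 + t m / m)` is concave wherever `t` is concave and nonnegative. -/
lemma ConcaveOn.mul_logb_two_one_add_div {s : Set ℝ} {t : ℝ → ℝ} (ht : ConcaveOn ℝ s t)
    (hs : ∀ m ∈ s, 0 < m) (hnonneg : ∀ m ∈ s, 0 ≤ t m) :
    ConcaveOn ℝ s (fun m : ℝ => m * Real.logb 2 (1 + t m / m)) := by
  refine ⟨ht.1, fun x hx y hy a b ha hb hab => ?_⟩
  have hx0 := hs x hx
  have hy0 := hs y hy
  have htx := hnonneg x hx
  have hty := hnonneg y hy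
  have hX : 0 < a * x + b * y := hs _ (ht.1 hx hy ha hb hab)
  have h := concaveOn_logb_two_one_add.perspective_le hx0 hy0
    (div_nonneg htx hx0.le) (div_nonneg hty hy0.le) ha hb hab
  have hle := ht.2 hx hy ha hb hab
  simp only [smul_eq_mul] at hle ⊢
  refine h.trans (mul_le_mul_of_nonneg_left ?_ hX.le)
  exact Real.logb_le_logb_of_le one_lt_two (by positivity) (by gcongr)

/-- Proposition 2: the relaying-scheme UAV throughput maximization problem
is convex in the IBL regime, i.e., the feasible set is convex and the UAV
throughput (24) is concave in the first-hop blocklength m₁. -/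
theorem relaying_ibl_problem_convex
    (M p0 β μ0 σ2 G1 G3 : ℝ)
    (hM : 0 < M) (hp0 : 0 < p0) (hβ : 0 < β) (hμ0 : 0 < μ0)
    (hσ2 : 0 < σ2) (hG1 : 0 < G1) (hG3 : 0 < G3) :
    let t : ℝ → ℝ := fun m1 =>
      (M * p0 - (M - m1) * ((2 : ℝ) ^ (β * μ0 / (M - m1)) - 1) * σ2 / G3)
        * G1 / σ2
    let μ : ℝ → ℝ := fun m1 =>
      m1 * Real.logb 2 (1 + t m1 / m1) - β * μ0
    let S : Set ℝ := {m1 | m1 ∈ Set.Ioo 0 M ∧ 0 ≤ t m1}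
    Convex ℝ S ∧ ConcaveOn ℝ S μ := by
  intro t μ S
  have ht : ConcaveOn ℝ (Set.Ioo 0 M) t := by
    refine (concaveOn_const_sub_mul_two_rpow M (M * p0 * G1 / σ2) (β * μ0) (G1 / G3)
      (by positivity)).congr fun m _ => ?_
    simp only [t]
    field_simp
  have hS : Convex ℝ S := ht.convex_ge 0
  have htS : ConcaveOn ℝ S t := ht.subset (fun _ hm => hm.1) hS
  exact ⟨hS, (htS.mul_logb_two_one_add_div (fun _ hm => hm.1.1) fun _ hm => hm.2).sub
    (convexOn_const (β * μ0) hS)⟩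
end

section
/- Let I ⊆ (0, ∞) be an interval and let t : I → ℝ be concave with m + t(m) > 0 for all m ∈ I. Then the function f(m) = m·log2(1 + t(m)/m) is concave on I. -/
/-- The perspective `m * log (s / m)` of the logarithm lies below its tangent plane along the ray
`s = w * m`. -/
lemma mul_log_div_le_tangent {m s w : ℝ} (hm : 0 < m) (hs : 0 < s) (hw : 0 < w) :
    m * Real.log (s / m) ≤ m * Real.log w + s / w - m := by
  have hlog := Real.log_le_sub_one_of_pos (show 0 < s / m / w by positivity)
  rw [Real.log_div (by positivity) hw.ne'] at hlog
  have hmul := mul_le_mul_of_nonneg_left hlog hm.le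
  have hcancel : m * (s / m / w - 1) = s / w - m := by field_simp
  linarith

/-- The perspective transform `m ↦ m * log (s m / m)` of a positive concave function `s` is
concave on sets of positive reals. -/
lemma ConcaveOn.mul_log_div {I : Set ℝ} (hI : I ⊆ Set.Ioi (0 : ℝ)) {s : ℝ → ℝ}
    (hs : ConcaveOn ℝ I s) (hpos : ∀ m ∈ I, 0 < s m) :
    ConcaveOn ℝ I (fun m : ℝ => m * Real.log (s m / m)) := by
  refine ⟨hs.1, fun x hx y hy a b ha hb hab => ?_⟩
  have hz := hs.1 hx hy ha hb hab
  have hsz := hs.2 hx hy ha hb hab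
  simp only [smul_eq_mul] at hz hsz ⊢
  set z := a * x + b * y with hz_def
  have hz0 : 0 < z := hI hz
  have hs0 : 0 < s z := hpos z hz
  have hw : 0 < s z / z := div_pos hs0 hz0
  have hxt := mul_le_mul_of_nonneg_left (mul_log_div_le_tangent (hI hx) (hpos x hx) hw) ha
  have hyt := mul_le_mul_of_nonneg_left (mul_log_div_le_tangent (hI hy) (hpos y hy) hw) hb
  have hslope : (a * s x + b * s y) / (s z / z) ≤ z :=
    (div_le_iff₀ hw).2 (by rwa [mul_div_cancel₀ _ hz0.ne'])
  calc a * (x * Real.log (s x / x)) + b * (y * Real.log (s y / y))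
      ≤ a * (x * Real.log (s z / z) + s x / (s z / z) - x)
        + b * (y * Real.log (s z / z) + s y / (s z / z) - y) := add_le_add hxt hyt
    _ = z * Real.log (s z / z) + (a * s x + b * s y) / (s z / z) - z := by
        rw [hz_def]; ring
    _ ≤ z * Real.log (s z / z) := by linarith

/-- Key analytic step (29) in the proof of Proposition 2: if t is concave
on an interval I ⊆ (0, ∞) with m + t(m) > 0 on I, then
`m ↦ m·log2(1 + t(m)/m)` is concave on I. -/
theorem concaveOn_mul_logb_one_add_div
    (I : Set ℝ) (hI : I ⊆ Set.Ioi (0 : ℝ)) (hIconv : Convex ℝ I)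
    (t : ℝ → ℝ) (ht : ConcaveOn ℝ I t)
    (hpos : ∀ m ∈ I, 0 < m + t m) :
    ConcaveOn ℝ I (fun m : ℝ => m * Real.logb 2 (1 + t m / m)) := by
  have hlog := (((concaveOn_id hIconv).add ht).mul_log_div hI hpos).smul
    (inv_nonneg.2 (Real.log_nonneg one_le_two))
  refine hlog.congr fun m hm => ?_
  have hm0 : m ≠ 0 := (hI hm).ne'
  simp only [Pi.add_apply, id_eq, smul_eq_mul, Real.logb, add_div, div_self hm0]
  ring
end

section
/- Let m ≥ 84 and 0 < q ≤ 6 be real numbers. Then the function γ ↦ log2(1 + γ) − log2(e)·q·sqrt(γ·(γ + 2)/((γ + 1)²·m)) + log2(m)/m is strictly increasing on the interval [1, ∞). -/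
/-- The SNR factor of the channel dispersion, in terms of `γ + 1`. -/
lemma dispersion_eq {m γ : ℝ} (hm : m ≠ 0) (hγ : γ + 1 ≠ 0) :
    γ * (γ + 2) / ((γ + 1) ^ 2 * m) = (1 - 1 / (γ + 1) ^ 2) / m := by
  field_simp
  ring

/-- From SNR `1` on, the square root of the dispersion dominates `q / m`. -/
lemma div_le_sqrt_dispersion {m q γ : ℝ} (hm : 84 ≤ m) (hq0 : 0 < q) (hq : q ≤ 6)
    (hγ : 1 ≤ γ) : q / m ≤ √(γ * (γ + 2) / ((γ + 1) ^ 2 * m)) := by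
  have hm0 : 0 < m := by linarith
  apply Real.le_sqrt_of_sq_le
  rw [div_pow, div_le_div_iff₀ (by positivity) (by positivity)]
  have hq2 : q ^ 2 ≤ 36 := by nlinarith
  have h3 : 3 * (γ + 1) ^ 2 ≤ 4 * (γ * (γ + 2)) := by nlinarith
  have hqm : 4 * q ^ 2 ≤ 3 * m := by linarith
  have h : q ^ 2 * (γ + 1) ^ 2 ≤ γ * (γ + 2) * m := by
    have h1 := mul_le_mul_of_nonneg_right hqm (sq_nonneg (γ + 1))
    have h2 := mul_le_mul_of_nonneg_right h3 hm0.le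
    linarith
  have := mul_le_mul_of_nonneg_right h hm0.le
  linarith

/-- The dispersion term grows by at most `1 / (a + 1) ^ 2 - 1 / (b + 1) ^ 2`. -/
lemma mul_sqrt_dispersion_sub_le {m q a b : ℝ} (hm : 84 ≤ m) (hq0 : 0 < q) (hq : q ≤ 6)
    (ha : 1 ≤ a) (hab : a < b) :
    q * (√(b * (b + 2) / ((b + 1) ^ 2 * m)) - √(a * (a + 2) / ((a + 1) ^ 2 * m)))
      ≤ 1 / (a + 1) ^ 2 - 1 / (b + 1) ^ 2 := by
  have hm0 : 0 < m := by linarith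
  have hb : 1 ≤ b := by linarith
  have hTa := div_le_sqrt_dispersion hm hq0 hq ha
  have hSa : √(a * (a + 2) / ((a + 1) ^ 2 * m)) ^ 2 = (1 - 1 / (a + 1) ^ 2) / m := by
    rw [Real.sq_sqrt (by positivity), dispersion_eq hm0.ne' (by positivity)]
  have hSb : √(b * (b + 2) / ((b + 1) ^ 2 * m)) ^ 2 = (1 - 1 / (b + 1) ^ 2) / m := by
    rw [Real.sq_sqrt (by positivity), dispersion_eq hm0.ne' (by positivity)]
  have hTb : 0 ≤ √(b * (b + 2) / ((b + 1) ^ 2 * m)) := Real.sqrt_nonneg _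
  have hD : 0 ≤ 1 / (a + 1) ^ 2 - 1 / (b + 1) ^ 2 :=
    sub_nonneg.2 (one_div_le_one_div_of_le (by positivity) (by gcongr))
  generalize √(a * (a + 2) / ((a + 1) ^ 2 * m)) = S at *
  generalize √(b * (b + 2) / ((b + 1) ^ 2 * m)) = T at *
  generalize 1 / (a + 1) ^ 2 = u at *
  generalize 1 / (b + 1) ^ 2 = v at *
  have hqm : 0 < q / m := by positivity
  have hST : 0 < S + T := by linarith
  refine le_of_mul_le_mul_right ?_ hST
  calc q * (T - S) * (S + T) = q * (T ^ 2 - S ^ 2) := by ring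
    _ = (u - v) * (q / m) := by rw [hSa, hSb]; ring
    _ ≤ (u - v) * (S + T) := mul_le_mul_of_nonneg_left (by linarith) hD

lemma one_div_sq_sub_lt_log_sub {x y : ℝ} (hx : 2 ≤ x) (hxy : x < y) :
    1 / x ^ 2 - 1 / y ^ 2 < Real.log y - Real.log x := by
  have hx0 : 0 < x := by linarith
  have hy0 : 0 < y := by linarith
  have hlog : 1 - x / y ≤ Real.log y - Real.log x := by
    have := Real.one_sub_inv_le_log_of_pos (div_pos hy0 hx0)
    rwa [inv_div, Real.log_div hy0.ne' hx0.ne'] at this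
  refine lt_of_lt_of_le ?_ hlog
  have key : 0 < x ^ 2 * y - (x + y) := by
    have hx2 : 4 ≤ x ^ 2 := by nlinarith
    have := mul_le_mul_of_nonneg_right hx2 hy0.le
    linarith
  have h : 1 - x / y - (1 / x ^ 2 - 1 / y ^ 2)
      = (y - x) * (x ^ 2 * y - (x + y)) / (x ^ 2 * y ^ 2) := by
    field_simp
    ring
  have : 0 < (y - x) * (x ^ 2 * y - (x + y)) / (x ^ 2 * y ^ 2) :=
    div_pos (mul_pos (sub_pos.2 hxy) key) (by positivity)
  linarith

/-- Proposition 3, first half: for blocklength m ≥ 84 and 0 < q ≤ 6 (q stands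
for Q⁻¹(ε)), the FBL normal-approximation rate
`γ ↦ log2(1+γ) − log2(e)·q·√(γ(γ+2)/((γ+1)²·m)) + log2(m)/m`
is strictly increasing in the SNR γ on [1, ∞). -/
theorem fbl_rate_strictMonoOn_snr
    (m q : ℝ) (hm : 84 ≤ m) (hq0 : 0 < q) (hq : q ≤ 6) :
    StrictMonoOn
      (fun γ : ℝ =>
        Real.logb 2 (1 + γ)
          - Real.logb 2 (Real.exp 1) * q
              * Real.sqrt (γ * (γ + 2) / ((γ + 1) ^ 2 * m))
          + Real.logb 2 m / m)
      (Set.Ici (1 : ℝ)) := by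
  intro a ha b _ hab
  have ha : 1 ≤ a := ha
  have h := (mul_sqrt_dispersion_sub_le hm hq0 hq ha hab).trans_lt
    (one_div_sq_sub_lt_log_sub (x := a + 1) (y := b + 1) (by linarith) (by linarith))
  have hlog2 : 0 < Real.log 2 := Real.log_pos one_lt_two
  have h' := div_lt_div_of_pos_right h hlog2
  simp only [Real.logb, Real.log_exp, add_comm (1 : ℝ)]
  ring_nf at h' ⊢
  linarith
end

section
/- Let γ ≥ 1 and 2.3263 ≤ q ≤ 5.9978 be real numbers. Then the function m ↦ log2(1 + γ) − log2(e)·q·sqrt(γ·(γ + 2)/((γ + 1)²·m)) + log2(m)/m is strictly increasing on the interval [84, ∞). -/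
theorem Real.neg_half_lt_mul_log {t : ℝ} (ht : 0 < t) : -(1 / 2) < t * Real.log t := by
  have hlog : Real.log (2 * t)⁻¹ ≤ (2 * t)⁻¹ - 1 := Real.log_le_sub_one_of_pos (by positivity)
  rw [Real.log_inv, Real.log_mul two_ne_zero ht.ne'] at hlog
  have hmul := mul_le_mul_of_nonneg_left hlog ht.le
  have hinv : t * ((2 * t)⁻¹ - 1) = 1 / 2 - t := by field_simp
  nlinarith [Real.log_two_lt_d9]

theorem strictMonoOn_mul_add_sq_mul_log {a : ℝ} (ha : 2 ≤ a) :
    StrictMonoOn (fun t : ℝ => a * t + 2 * (t * (t * Real.log t))) (Set.Ioi 0) := by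
  have hderiv : ∀ t ∈ Set.Ioi (0 : ℝ), HasDerivAt
      (fun t : ℝ => a * t + 2 * (t * (t * Real.log t)))
      (a * 1 + 2 * (1 * (t * Real.log t) + t * (Real.log t + 1))) t := fun t ht =>
    ((hasDerivAt_id t).const_mul a).add
      (((hasDerivAt_id t).mul (Real.hasDerivAt_mul_log (ne_of_gt ht))).const_mul 2)
  refine strictMonoOn_of_deriv_pos (convex_Ioi 0)
    (fun t ht => (hderiv t ht).continuousAt.continuousWithinAt) fun t ht => ?_
  rw [interior_Ioi] at ht
  rw [(hderiv t ht).deriv]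
  have ht0 : 0 < t := ht
  linarith [Real.neg_half_lt_mul_log ht0]

theorem strictMonoOn_log_div_sub_inv_sqrt {a : ℝ} (ha : 2 ≤ a) :
    StrictMonoOn (fun m : ℝ => Real.log m / m - a * (√m)⁻¹) (Set.Ioi 0) := by
  have heq : ∀ m : ℝ, 0 < m → Real.log m / m - a * (√m)⁻¹ =
      -(a * (√m)⁻¹ + 2 * ((√m)⁻¹ * ((√m)⁻¹ * Real.log (√m)⁻¹))) := fun m hm => by
    rw [Real.log_inv, Real.log_sqrt hm.le, ← mul_assoc (√m)⁻¹, ← mul_inv,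
      Real.mul_self_sqrt hm.le]
    ring
  intro x hx y hy hxy
  have hx0 : 0 < x := hx
  have hy0 : 0 < y := hy
  have hinv : (√y)⁻¹ < (√x)⁻¹ :=
    inv_strictAnti₀ (Real.sqrt_pos.2 hx0) (Real.sqrt_lt_sqrt hx0.le hxy)
  simp only [heq x hx0, heq y hy0]
  exact neg_lt_neg (strictMonoOn_mul_add_sq_mul_log ha
    (inv_pos.2 (Real.sqrt_pos.2 hy0)) (inv_pos.2 (Real.sqrt_pos.2 hx0)) hinv)

/-- Proposition 3, second half: for SNR γ ≥ 1 and 2.3263 ≤ q ≤ 5.9978 (q stands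
for Q⁻¹(ε)), the FBL normal-approximation rate
`m ↦ log2(1+γ) − log2(e)·q·√(γ(γ+2)/((γ+1)²·m)) + log2(m)/m`
is strictly increasing in the blocklength m on [84, ∞). -/
theorem fbl_rate_strictMonoOn_blocklength
    (γ q : ℝ) (hγ : 1 ≤ γ) (hq0 : 2.3263 ≤ q) (hq : q ≤ 5.9978) :
    StrictMonoOn
      (fun m : ℝ =>
        Real.logb 2 (1 + γ)
          - Real.logb 2 (Real.exp 1) * q
              * Real.sqrt (γ * (γ + 2) / ((γ + 1) ^ 2 * m))
          + Real.logb 2 m / m)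
      (Set.Ici (84 : ℝ)) := by
  have hc : 0.866 ≤ √(γ * (γ + 2) / (γ + 1) ^ 2) := by
    apply Real.le_sqrt_of_sq_le
    rw [le_div_iff₀ (by positivity)]
    nlinarith
  have ha : 2 ≤ q * √(γ * (γ + 2) / (γ + 1) ^ 2) := by nlinarith
  have heq : ∀ m : ℝ, Real.logb 2 (1 + γ)
      - Real.logb 2 (Real.exp 1) * q * √(γ * (γ + 2) / ((γ + 1) ^ 2 * m)) + Real.logb 2 m / m =
      Real.logb 2 (1 + γ) + (Real.log m / m
        - q * √(γ * (γ + 2) / (γ + 1) ^ 2) * (√m)⁻¹) / Real.log 2 := fun m => by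
    rw [← div_div, Real.sqrt_div (by positivity) m]
    simp only [Real.logb, Real.log_exp]
    ring
  intro x hx y hy hxy
  have hpos : Set.Ici (84 : ℝ) ⊆ Set.Ioi 0 := Set.Ici_subset_Ioi.2 (by norm_num)
  simp only [heq]
  have hlt := strictMonoOn_log_div_sub_inv_sqrt ha (hpos hx) (hpos hy) hxy
  have hlog : 0 < Real.log 2 := Real.log_pos one_lt_two
  gcongr
end

section
/- Let A ≥ 0, B ≥ 0 and let t0 ≥ 2, t2' ≥ 2 be real numbers satisfying log2(t2') − A·sqrt(1 − 1/t2'²) − B = 2·(log2(t0) − A·sqrt(1 − 1/t0²) − B). Then log2(t2') ≤ 2·log2(t0), i.e., t2' ≤ t0². -/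
/-- Lemma 1: if the FBL throughput guarantee over the relay hop,
`log2(t2') − A·√(1 − 1/t2'²) − B = 2·(log2(t0) − A·√(1 − 1/t0²) − B)`,
holds with A, B ≥ 0 and t0, t2' ≥ 2, then `log2(t2') ≤ 2·log2(t0)`, i.e.,
`t2' ≤ t0²` — guaranteeing the ground user in the FBL regime needs less
second-hop power than in the IBL regime. -/
theorem fbl_requires_less_relay_power
    (A B t0 t2' : ℝ) (hA : 0 ≤ A) (hB : 0 ≤ B) (ht0 : 2 ≤ t0) (ht2 : 2 ≤ t2')
    (heq : Real.logb 2 t2' - A * Real.sqrt (1 - 1 / t2' ^ 2) - B =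
      2 * (Real.logb 2 t0 - A * Real.sqrt (1 - 1 / t0 ^ 2) - B)) :
    Real.logb 2 t2' ≤ 2 * Real.logb 2 t0 ∧ t2' ≤ t0 ^ 2 := by
  have hs2 : Real.sqrt (1 - 1 / t2' ^ 2) ≤ 1 := by
    rw [Real.sqrt_le_one]
    have : 0 ≤ 1 / t2' ^ 2 := by positivity
    linarith
  have hs0 : 1 / 2 ≤ Real.sqrt (1 - 1 / t0 ^ 2) := by
    apply Real.le_sqrt_of_sq_le
    have : 1 / t0 ^ 2 ≤ 1 / 2 ^ 2 := by gcongr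
    linarith
  have hlog : Real.logb 2 t2' ≤ 2 * Real.logb 2 t0 := by
    have := mul_le_mul_of_nonneg_left
      (show Real.sqrt (1 - 1 / t2' ^ 2) ≤ 2 * Real.sqrt (1 - 1 / t0 ^ 2) by linarith) hA
    linarith
  refine ⟨hlog, ?_⟩
  have hpow : Real.logb 2 (t0 ^ 2) = 2 * Real.logb 2 t0 := by
    simp [Real.logb_pow]
  rw [← hpow] at hlog
  exact (Real.logb_le_logb one_lt_two (by linarith) (by positivity)).1 hlog
end
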